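/- arXiv:0805.1131 — 6 statements merged into one kernel-verified Lean document; each statement's English description precedes it below -/
import Mathlib

section
/- Let d ≥ 1 and let {V_p}_{p≥2}, V_p : (ℝ^d)^p → ℝ, be a family of p-body potentials satisfying assumptions A1–A4 with respect to a partition of ℝ^d into cubes of side λ. Suppose the two-body part U^(2)(γ) = Σ_{{x,y}⊂γ} V_2(x,y) is stable, i.e. there exists B_2 > 0 with U^(2)(γ) ≥ −B_2|γ| for every finite configuration γ. If, for this partition, for every p > 2 one has (1) V_p^p(Δ)/p^p − p·I_p^{1|p−1}(Δ) ≥ 0 for every cube Δ, and (2) Σ_{p>2} p^{p+1} I_p^{1|p−1}(Δ) < +∞, then the full interaction is stable: U(γ) ≥ −B|γ| for every finite configuration γ, with B = B_2 + Σ_{p>2} p^{p+1} I_p^{1|p−1}. -/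
open MeasureTheory
open scoped ENNReal BigOperators

noncomputable section

/-- Points of `ℝ^d`. -/
abbrev Pt (d : ℕ) := EuclideanSpace ℝ (Fin d)

/-- The elementary cube with rib `lam` centered at the lattice point `lam • r`. -/
def cube (d : ℕ) (lam : ℝ) (r : Fin d → ℤ) : Set (Pt d) :=
  {x | ∀ i, lam * ((r i : ℝ) - 1 / 2) ≤ x i ∧ x i < lam * ((r i : ℝ) + 1 / 2)}

open scoped Classical in
/-- `|γ_Δ|`: the number of points of the finite configuration `γ` in the cube labelled `r`. -/
def occupancy (d : ℕ) (lam : ℝ) (γ : Finset (Pt d)) (r : Fin d → ℤ) : ℕ :=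
  (γ.filter fun x => x ∈ cube d lam r).card

/-- Concatenate a `k`-tuple and a `(p-k)`-tuple into a `p`-tuple. -/
def joinAt {α : Type*} (p k : ℕ) (h : k ≤ p) (y : Fin k → α) (z : Fin (p - k) → α) :
    Fin p → α :=
  fun i => Fin.append y z (Fin.cast ((Nat.add_sub_cancel' h).symm) i)

/-- The set of (ordered) pairs `i < j` in `Fin p`. -/
def pairs (p : ℕ) : Finset (Fin p × Fin p) := Finset.univ.filter fun q => q.1 < q.2

/-- `Σ_{1 ≤ i < j ≤ p} |x_i - x_j|`. -/
def pairSum (p : ℕ) (x : Fin p → ℝ) : ℝ := ∑ q ∈ pairs p, |x q.1 - x q.2|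

/-- `I_p^{k_1,…,k_n}(Δ_1,…,Δ_n)`: the sup of `|V_p^-|` over choices of `k_1` points in the
cube labelled `r 1`, …, `k_n` points in the cube labelled `r n`. -/
def IblocksT (d : ℕ) (lam : ℝ) (V : (p : ℕ) → (Fin p → Pt d) → ℝ) (p : ℕ)
    {n : ℕ} (ks : Fin n → ℕ) (r : Fin n → Fin d → ℤ) : ℝ≥0∞ :=
  ⨆ (x : Fin p → Pt d) (_ : ∃ c : Fin p → Fin n,
      (∀ i, x i ∈ cube d lam (r (c i))) ∧
      ∀ b, (Finset.univ.filter fun i => c i = b).card = ks b),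
    ENNReal.ofReal |min (V p x) 0|

/-- The analogue of `IblocksT` where the number of points to be put in the cube labelled `s`
is prescribed by the function `κ`. -/
def IblocksF (d : ℕ) (lam : ℝ) (V : (p : ℕ) → (Fin p → Pt d) → ℝ) (p : ℕ)
    (κ : (Fin d → ℤ) → ℕ) : ℝ≥0∞ :=
  ⨆ (x : Fin p → Pt d) (_ : ∃ c : Fin p → Fin d → ℤ,
      (∀ i, x i ∈ cube d lam (c i)) ∧
      ∀ s, (Finset.univ.filter fun i => c i = s).card = κ s),
    ENNReal.ofReal |min (V p x) 0|

/-- `I_p^{k|m}(Δ)`: the sum over all ordered `m`-tuples of cubes `(Δ_1,…,Δ_m)` of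
`I_p^{k,1,…,1}(Δ,Δ_1,…,Δ_m)`, where `Δ` is the cube labelled `r`. -/
def Ikm (d : ℕ) (lam : ℝ) (V : (p : ℕ) → (Fin p → Pt d) → ℝ) (p k m : ℕ)
    (r : Fin d → ℤ) : ℝ≥0∞ :=
  ∑' rs : Fin m → Fin d → ℤ,
    IblocksT d lam V p (Fin.cons k fun _ => 1) (Fin.cons r rs)

/-- `I_p^{k | {k_1,…,k_m}}(Δ)`: the sum over all unordered families of pairwise distinct
cubes, all different from `Δ`, carrying the multiset of counts `K`, of the corresponding
`I_p^{k,k_{π(1)},…,k_{π(m)}}(Δ,Δ_1,…,Δ_m)` (distinct rearrangements counted once). -/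
def IpartSet (d : ℕ) (lam : ℝ) (V : (p : ℕ) → (Fin p → Pt d) → ℝ) (p : ℕ)
    (k : ℕ) (K : Multiset ℕ) (r : Fin d → ℤ) : ℝ≥0∞ :=
  ∑' κ : {κ : (Fin d → ℤ) → ℕ //
      κ r = 0 ∧ ∃ S : Finset (Fin d → ℤ), (∀ s, κ s ≠ 0 ↔ s ∈ S) ∧ S.val.map κ = K},
    IblocksF d lam V p (Function.update (κ : (Fin d → ℤ) → ℕ) r k)

/-- `V_p^p(Δ)`: the infimum of `V_p^+` over `p`-tuples of points of the cube labelled `r`. -/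
def Vpp (d : ℕ) (lam : ℝ) (V : (p : ℕ) → (Fin p → Pt d) → ℝ) (p : ℕ)
    (r : Fin d → ℤ) : ℝ :=
  ⨅ x : {x : Fin p → Pt d // ∀ i, x i ∈ cube d lam r}, max (V p (x : Fin p → Pt d)) 0

/-- Evaluation of `V_p` on a `p`-element finite set of points (well defined for symmetric
`V_p`). -/
def evalSubset (d : ℕ) (V : (p : ℕ) → (Fin p → Pt d) → ℝ) (p : ℕ) (η : Finset (Pt d)) : ℝ :=
  if h : η.toList.length = p then V p (fun i => η.toList.get (Fin.cast h.symm i)) else 0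

/-- `U^{(p)}(γ) = Σ_{{x_1,…,x_p} ⊂ γ} V_p(x_1,…,x_p)`. -/
def pEnergy (d : ℕ) (V : (p : ℕ) → (Fin p → Pt d) → ℝ) (p : ℕ) (γ : Finset (Pt d)) : ℝ :=
  ∑ η ∈ γ.powersetCard p, evalSubset d V p η

/-- `U(γ) = Σ_{p ≥ 2} U^{(p)}(γ)`. -/
def energy (d : ℕ) (V : (p : ℕ) → (Fin p → Pt d) → ℝ) (γ : Finset (Pt d)) : ℝ :=
  ∑ p ∈ Finset.Icc 2 γ.card, pEnergy d V p γ

/-- Assumptions A1–A4 of the paper. -/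
structure ManyBodyAssumptions (d : ℕ) (lam : ℝ)
    (V : (p : ℕ) → (Fin p → Pt d) → ℝ) : Prop where
  /-- A1: symmetry. -/
  symm : ∀ p, 2 ≤ p → ∀ (x : Fin p → Pt d) (π : Equiv.Perm (Fin p)), V p (x ∘ π) = V p x
  /-- A2: translation invariance. -/
  transl : ∀ p, 2 ≤ p → ∀ (x : Fin p → Pt d) (a : Pt d), V p (fun i => x i + a) = V p x
  /-- A3: repulsion for small distances. -/
  repel : ∀ p, 2 ≤ p → ∀ (r : Fin d → ℤ) (x : Fin p → Pt d),
    (∀ i, x i ∈ cube d lam r) → 0 ≤ V p x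
  /-- A4: integrability. -/
  integrable : ∀ p (hp : 2 ≤ p) k (hk1 : 1 ≤ k) (hk2 : k ≤ p - 1),
    (⨆ y : Fin k → Pt d, ∫⁻ z : Fin (p - k) → Pt d,
      ENNReal.ofReal |min (V p (joinAt p k (by omega) y z)) 0|) < ⊤

end

/-- Every point of `ℝ^d` lies in some cube of the partition. -/
lemma exists_cube_label (d : ℕ) {lam : ℝ} (hlam : 0 < lam) :
    ∃ c : Pt d → Fin d → ℤ, ∀ x, x ∈ cube d lam (c x) := by
  refine ⟨fun x i => ⌊x i / lam + 1 / 2⌋, fun x i => ?_⟩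
  have h := Int.floor_le (x i / lam + 1 / 2)
  have h' := Int.lt_floor_add_one (x i / lam + 1 / 2)
  constructor
  · rw [mul_comm, ← le_div_iff₀ hlam]
    linarith
  · rw [mul_comm, ← div_lt_iff₀ hlam]
    linarith

/-- Cubes of the partition are lattice translates of each other. -/
lemma add_mem_cube {d : ℕ} {lam : ℝ} {x : Pt d} {r : Fin d → ℤ} (hx : x ∈ cube d lam r)
    (a : Fin d → ℤ) :
    x + WithLp.toLp 2 (fun i => lam * (a i : ℝ)) ∈ cube d lam (r + a) := by
  intro i
  have h := hx i
  simp only [PiLp.add_apply, Pi.add_apply, Int.cast_add]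
  constructor <;> nlinarith [h.1, h.2]

section Attraction

variable {d : ℕ} {lam : ℝ} {V : (p : ℕ) → (Fin p → Pt d) → ℝ}

lemma IblocksT_le_translate {p : ℕ}
    (htr : ∀ (x : Fin p → Pt d) (a : Pt d), V p (fun i => x i + a) = V p x)
    {n : ℕ} (ks : Fin n → ℕ) (r : Fin n → Fin d → ℤ) (a : Fin d → ℤ) :
    IblocksT d lam V p ks r ≤ IblocksT d lam V p ks (fun b => r b + a) := by
  refine iSup₂_le fun x ⟨c, hc, hcard⟩ => ?_
  rw [← htr x (WithLp.toLp 2 (fun i => lam * (a i : ℝ)))]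
  exact le_iSup₂_of_le (fun i => x i + WithLp.toLp 2 (fun i => lam * (a i : ℝ)))
    ⟨c, fun i => add_mem_cube (hc i) a, hcard⟩ le_rfl

lemma IblocksT_translate {p : ℕ}
    (htr : ∀ (x : Fin p → Pt d) (a : Pt d), V p (fun i => x i + a) = V p x)
    {n : ℕ} (ks : Fin n → ℕ) (r : Fin n → Fin d → ℤ) (a : Fin d → ℤ) :
    IblocksT d lam V p ks (fun b => r b + a) = IblocksT d lam V p ks r := by
  refine le_antisymm ?_ (IblocksT_le_translate htr ks r a)
  simpa using IblocksT_le_translate (lam := lam) htr ks (fun b => r b + a) (-a)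

lemma Ikm_translate {p : ℕ}
    (htr : ∀ (x : Fin p → Pt d) (a : Pt d), V p (fun i => x i + a) = V p x)
    (k m : ℕ) (r : Fin d → ℤ) :
    Ikm d lam V p k m r = Ikm d lam V p k m 0 := by
  unfold Ikm
  rw [← (Equiv.addRight (fun _ : Fin m => r)).tsum_eq]
  refine tsum_congr fun rs => ?_
  rw [← IblocksT_translate htr _ (Fin.cons 0 rs) r]
  congr 1
  ext b : 1
  refine Fin.cases ?_ (fun j => ?_) b <;> simp

lemma IblocksT_le_comp_perm {p n : ℕ} (r : Fin n → Fin d → ℤ) (σ : Equiv.Perm (Fin n)) :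
    IblocksT d lam V p (fun _ => 1) (r ∘ σ) ≤ IblocksT d lam V p (fun _ => 1) r := by
  refine iSup₂_le fun x ⟨c, hc, hcard⟩ => ?_
  refine le_iSup₂_of_le x ⟨σ ∘ c, hc, fun b => ?_⟩ le_rfl
  rw [← hcard (σ.symm b)]
  congr 1
  ext i
  simp [Equiv.eq_symm_apply]

lemma IblocksT_comp_perm {p n : ℕ} (r : Fin n → Fin d → ℤ) (σ : Equiv.Perm (Fin n)) :
    IblocksT d lam V p (fun _ => 1) (r ∘ σ) = IblocksT d lam V p (fun _ => 1) r := by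
  refine le_antisymm (IblocksT_le_comp_perm r σ) ?_
  simpa [Function.comp_assoc] using
    IblocksT_le_comp_perm (lam := lam) (V := V) (p := p) (r ∘ σ) σ.symm

lemma le_IblocksT {p : ℕ} {x : Fin p → Pt d} {t : Fin p → Fin d → ℤ}
    (h : ∀ i, x i ∈ cube d lam (t i)) :
    ENNReal.ofReal |min (V p x) 0| ≤ IblocksT d lam V p (fun _ => 1) t :=
  le_iSup₂_of_le x ⟨id, h, fun b => Finset.card_eq_one.2 ⟨b, by ext; simp⟩⟩ le_rfl

lemma Ikm_one_eq (m : ℕ) (r : Fin d → ℤ) :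
    Ikm d lam V (m + 1) 1 m r =
      ∑' rs : Fin m → Fin d → ℤ, IblocksT d lam V (m + 1) (fun _ => 1) (Fin.cons r rs) := by
  unfold Ikm
  refine tsum_congr fun rs => ?_
  congr 1
  ext b : 1
  refine Fin.cases ?_ (fun j => ?_) b <;> simp

lemma tsum_mul_IblocksT (m : ℕ) (w : (Fin d → ℤ) → ℝ≥0∞) (i : Fin (m + 1)) :
    ∑' t : Fin (m + 1) → Fin d → ℤ, w (t i) * IblocksT d lam V (m + 1) (fun _ => 1) t =
      ∑' r, w r * Ikm d lam V (m + 1) 1 m r := by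
  have hperm := (Equiv.arrowCongr (Equiv.swap 0 i) (Equiv.refl (Fin d → ℤ))).tsum_eq
    (fun t => w (t i) * IblocksT d lam V (m + 1) (fun _ => 1) t)
  have hcons := (Fin.consEquiv (fun _ : Fin (m + 1) => Fin d → ℤ)).tsum_eq
    (fun t => w (t 0) * IblocksT d lam V (m + 1) (fun _ => 1) t)
  calc _ = ∑' t : Fin (m + 1) → Fin d → ℤ,
        w (t 0) * IblocksT d lam V (m + 1) (fun _ => 1) t := by
        rw [← hperm]
        refine tsum_congr fun t => ?_
        rw [← IblocksT_comp_perm t (Equiv.swap 0 i).symm]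
        simp [Equiv.arrowCongr]
    _ = _ := by
        rw [← hcons, ENNReal.tsum_prod']
        refine tsum_congr fun r => ?_
        rw [Ikm_one_eq, ← ENNReal.tsum_mul_left]
        rfl

lemma prod_le_sum_pow {m : ℕ} (a : Fin (m + 1) → ℕ) : ∏ i, a i ≤ ∑ i, a i ^ (m + 1) := by
  obtain ⟨j, -, hj⟩ := Finset.exists_max_image Finset.univ a Finset.univ_nonempty
  calc ∏ i, a i ≤ ∏ _i : Fin (m + 1), a j := Finset.prod_le_prod' fun i hi => hj i hi
    _ = a j ^ (m + 1) := by simp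
    _ ≤ _ := Finset.single_le_sum (f := fun i => a i ^ (m + 1)) (fun _ _ => Nat.zero_le _)
      (Finset.mem_univ j)

/-- The total attraction between all ordered `(m+1)`-tuples of points of `γ`. -/
lemma sum_attraction_le (m : ℕ) (γ : Finset (Pt d)) {c : Pt d → Fin d → ℤ}
    (hc : ∀ x, x ∈ cube d lam (c x)) :
    ∑ x ∈ Fintype.piFinset (fun _ : Fin (m + 1) => γ),
        ENNReal.ofReal |min (V (m + 1) x) 0| ≤
      ((m + 1 : ℕ) : ℝ≥0∞) * ∑' r, (((γ.filter fun x => c x = r).card ^ (m + 1) : ℕ) : ℝ≥0∞) *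
        Ikm d lam V (m + 1) 1 m r := by
  set n : (Fin d → ℤ) → ℕ := fun r => (γ.filter fun x => c x = r).card with hn
  set J : (Fin (m + 1) → Fin d → ℤ) → ℝ≥0∞ :=
    fun t => IblocksT d lam V (m + 1) (fun _ => 1) t with hJ
  have hfib : ∀ t : Fin (m + 1) → Fin d → ℤ,
      ((Fintype.piFinset fun _ : Fin (m + 1) => γ).filter fun x => c ∘ x = t).card =
        ∏ i, n (t i) := by
    intro t
    rw [hn, ← Fintype.card_piFinset]
    congr 1
    ext x
    simp [funext_iff, forall_and]
  calc _ ≤ ∑ x ∈ Fintype.piFinset (fun _ : Fin (m + 1) => γ), J (c ∘ x) :=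
        Finset.sum_le_sum fun x _ => le_IblocksT fun i => hc (x i)
    _ = ∑ t ∈ (Fintype.piFinset fun _ : Fin (m + 1) => γ).image (c ∘ ·),
          ((∏ i, n (t i) : ℕ) : ℝ≥0∞) * J t := by
        rw [Finset.sum_comp J (c ∘ ·)]
        refine Finset.sum_congr rfl fun t _ => ?_
        rw [hfib, nsmul_eq_mul]
    _ ≤ ∑' t, ((∏ i, n (t i) : ℕ) : ℝ≥0∞) * J t := ENNReal.sum_le_tsum _
    _ ≤ ∑' t, ∑ i, ((n (t i) ^ (m + 1) : ℕ) : ℝ≥0∞) * J t := by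
        refine ENNReal.tsum_le_tsum fun t => ?_
        rw [← Finset.sum_mul]
        gcongr
        exact_mod_cast prod_le_sum_pow fun i => n (t i)
    _ = ∑ i, ∑' t, ((n (t i) ^ (m + 1) : ℕ) : ℝ≥0∞) * J t :=
        Summable.tsum_finsetSum fun _ _ => ENNReal.summable
    _ = _ := by
        simp_rw [hJ, tsum_mul_IblocksT m (fun r => ((n r ^ (m + 1) : ℕ) : ℝ≥0∞))]
        simp [hn]

end Attraction

lemma pow_le_pow_self_mul_choose (k : ℕ) : ∀ n, k ≤ n → n ^ k ≤ k ^ k * n.choose k := by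
  induction k with
  | zero => simp
  | succ k ih =>
    intro n hn
    obtain ⟨n, rfl⟩ : ∃ l, n = l + 1 := ⟨n - 1, by omega⟩
    rcases Nat.eq_zero_or_pos k with rfl | hk
    · simp
    refine Nat.le_of_mul_le_mul_left ?_ (pow_pos hk k)
    have hkn : k * (n + 1) ≤ (k + 1) * n := by nlinarith
    calc k ^ k * (n + 1) ^ (k + 1)
      _ = (k * (n + 1)) ^ k * (n + 1) := by rw [mul_pow, pow_succ, mul_assoc]
      _ ≤ ((k + 1) * n) ^ k * (n + 1) := by gcongr
      _ = (k + 1) ^ k * (n + 1) * n ^ k := by rw [mul_pow, mul_right_comm]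
      _ ≤ (k + 1) ^ k * (n + 1) * (k ^ k * n.choose k) := by
        gcongr
        exact ih n (by omega)
      _ = k ^ k * ((k + 1) ^ k * ((n + 1) * n.choose k)) := by ring
      _ = k ^ k * ((k + 1) ^ (k + 1) * (n + 1).choose (k + 1)) := by
        rw [Nat.add_one_mul_choose_eq]
        ring

section Energy

variable {d : ℕ} {lam : ℝ} {V : (p : ℕ) → (Fin p → Pt d) → ℝ}

lemma exists_enumeration (V : (p : ℕ) → (Fin p → Pt d) → ℝ) (p : ℕ) :
    ∃ e : Finset (Pt d) → Fin p → Pt d, ∀ η : Finset (Pt d), η.card = p →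
      evalSubset d V p η = V p (e η) ∧ Set.range (e η) = η := by
  have h : ∀ η : Finset (Pt d), ∃ x : Fin p → Pt d, η.card = p →
      evalSubset d V p η = V p x ∧ Set.range x = η := by
    intro η
    by_cases hη : η.card = p
    · have hl : η.toList.length = p := by simpa using hη
      refine ⟨fun i => η.toList.get (Fin.cast hl.symm i), fun _ => ⟨by simp [evalSubset, hl], ?_⟩⟩
      subst hl
      ext y
      have := List.mem_iff_get (a := y) (l := η.toList)
      simpa using this.symm
    · exact ⟨fun _ => 0, fun h => absurd h hη⟩
  exact ⟨fun η => (h η).choose, fun η => (h η).choose_spec⟩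

lemma Vpp_nonneg (p : ℕ) (r : Fin d → ℤ) : 0 ≤ Vpp d lam V p r :=
  Real.iInf_nonneg fun _ => le_max_right _ _

lemma Vpp_le {p : ℕ} {r : Fin d → ℤ} {x : Fin p → Pt d} (hx : ∀ i, x i ∈ cube d lam r) :
    Vpp d lam V p r ≤ max (V p x) 0 :=
  ciInf_le (f := fun x : {x : Fin p → Pt d // ∀ i, x i ∈ cube d lam r} =>
    max (V p (x : Fin p → Pt d)) 0) ⟨0, by rintro _ ⟨y, rfl⟩; exact le_max_right _ _⟩ ⟨x, hx⟩

/-- The repulsion inside single cubes bounds the total repulsion from below. -/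
lemma sum_choose_mul_Vpp_le {p : ℕ} (hp : 0 < p) (γ : Finset (Pt d)) {c : Pt d → Fin d → ℤ}
    (hc : ∀ x, x ∈ cube d lam (c x)) {e : Finset (Pt d) → Fin p → Pt d}
    (he : ∀ η : Finset (Pt d), η.card = p → Set.range (e η) = η) :
    ∑ r ∈ γ.image c, ((γ.filter fun x => c x = r).card.choose p : ℝ) * Vpp d lam V p r ≤
      ∑ η ∈ γ.powersetCard p, max (V p (e η)) 0 := by
  classical
  have hdisj : Set.PairwiseDisjoint (↑(γ.image c))
      (fun r => (γ.filter fun x => c x = r).powersetCard p) := by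
    intro r _ s _ hrs
    refine Finset.disjoint_left.2 fun η hr hs => hrs ?_
    rw [Finset.mem_powersetCard] at hr hs
    obtain ⟨x, hx⟩ := Finset.card_pos.1 (hr.2 ▸ hp)
    rw [← (Finset.mem_filter.1 (hr.1 hx)).2, (Finset.mem_filter.1 (hs.1 hx)).2]
  calc _ ≤ ∑ r ∈ γ.image c, ∑ η ∈ (γ.filter fun x => c x = r).powersetCard p,
        max (V p (e η)) 0 := by
        refine Finset.sum_le_sum fun r _ => ?_
        rw [← Finset.card_powersetCard, ← nsmul_eq_mul]
        refine Finset.card_nsmul_le_sum _ _ _ fun η hη => Vpp_le fun i => ?_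
        rw [Finset.mem_powersetCard] at hη
        have hi : e η i ∈ η := by
          have : e η i ∈ (η : Set (Pt d)) := he η hη.2 ▸ Set.mem_range_self i
          exact this
        exact (Finset.mem_filter.1 (hη.1 hi)).2 ▸ hc (e η i)
    _ = ∑ η ∈ (γ.image c).biUnion fun r => (γ.filter fun x => c x = r).powersetCard p,
        max (V p (e η)) 0 := (Finset.sum_biUnion hdisj).symm
    _ ≤ _ := by
        refine Finset.sum_le_sum_of_subset_of_nonneg (fun η hη => ?_)
          fun _ _ _ => le_max_right _ _
        obtain ⟨r, -, hr⟩ := Finset.mem_biUnion.1 hη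
        exact Finset.powersetCard_mono (Finset.filter_subset _ _) hr

lemma sum_negPart_le (m : ℕ) (γ : Finset (Pt d)) {c : Pt d → Fin d → ℤ}
    (hc : ∀ x, x ∈ cube d lam (c x)) {e : Finset (Pt d) → Fin (m + 1) → Pt d}
    (he : ∀ η : Finset (Pt d), η.card = m + 1 → Set.range (e η) = η)
    {I : ℝ≥0∞} (hI : I ≠ ⊤) (hIkm : ∀ r, Ikm d lam V (m + 1) 1 m r = I) :
    ∑ η ∈ γ.powersetCard (m + 1), |min (V (m + 1) (e η)) 0| ≤
      ((m + 1 : ℕ) : ℝ) * (∑ r ∈ γ.image c,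
        ((γ.filter fun x => c x = r).card : ℝ) ^ (m + 1)) * I.toReal := by
  classical
  have hinj : Set.InjOn e ↑(γ.powersetCard (m + 1)) := by
    intro η hη ξ hξ h
    rw [Finset.mem_coe, Finset.mem_powersetCard] at hη hξ
    rw [← Finset.coe_inj, ← he η hη.2, ← he ξ hξ.2, h]
  have hsub : (γ.powersetCard (m + 1)).image e ⊆ Fintype.piFinset fun _ => γ := by
    intro x hx
    obtain ⟨η, hη, rfl⟩ := Finset.mem_image.1 hx
    rw [Finset.mem_powersetCard] at hη
    refine Fintype.mem_piFinset.2 fun i => hη.1 ?_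
    have : e η i ∈ (η : Set (Pt d)) := he η hη.2 ▸ Set.mem_range_self i
    exact this
  have hle := (Finset.sum_le_sum_of_subset (f := fun x => ENNReal.ofReal |min (V (m + 1) x) 0|)
    hsub).trans (sum_attraction_le m γ hc)
  rw [Finset.sum_image hinj, ← ENNReal.ofReal_sum_of_nonneg fun _ _ => abs_nonneg _] at hle
  simp_rw [hIkm] at hle
  rw [tsum_eq_sum (s := γ.image c), ← Finset.sum_mul, ← mul_assoc] at hle
  · refine ((ENNReal.ofReal_le_iff_le_toReal (ENNReal.mul_ne_top ?_ hI)).1 hle).trans_eq ?_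
    · exact_mod_cast ENNReal.natCast_ne_top ((m + 1) * _)
    · rw [← Nat.cast_sum, ← Nat.cast_mul, ENNReal.toReal_mul, ENNReal.toReal_natCast]
      push_cast
      rfl
  · intro r hr
    have : (γ.filter fun x => c x = r) = ∅ :=
      Finset.filter_eq_empty_iff.2 fun x hx hxr => hr (Finset.mem_image.2 ⟨x, hx, hxr⟩)
    simp [this]

/-- Stability of the `p`-body energy when repulsion in a cube dominates attraction. -/
lemma pEnergy_ge (hlam : 0 < lam) (m : ℕ) {I : ℝ≥0∞} (hI : I ≠ ⊤)
    (hIkm : ∀ r, Ikm d lam V (m + 1) 1 m r = I)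
    (hV : ∀ r, ((m + 1 : ℕ) : ℝ) ^ (m + 2) * I.toReal ≤ Vpp d lam V (m + 1) r)
    (γ : Finset (Pt d)) :
    -(((m + 1 : ℕ) : ℝ) ^ (m + 2) * I.toReal) * γ.card ≤ pEnergy d V (m + 1) γ := by
  obtain ⟨c, hc⟩ := exists_cube_label d hlam
  obtain ⟨e, he⟩ := exists_enumeration V (m + 1)
  have hpos := sum_choose_mul_Vpp_le (V := V) m.succ_pos γ hc fun η hη => (he η hη).2
  have hneg := sum_negPart_le m γ hc (fun η hη => (he η hη).2) hI hIkm
  have hsplit : pEnergy d V (m + 1) γ =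
      ∑ η ∈ γ.powersetCard (m + 1), max (V (m + 1) (e η)) 0 -
        ∑ η ∈ γ.powersetCard (m + 1), |min (V (m + 1) (e η)) 0| := by
    rw [pEnergy, ← Finset.sum_sub_distrib]
    refine Finset.sum_congr rfl fun η hη => ?_
    rw [(he η (Finset.mem_powersetCard.1 hη).2).1, abs_of_nonpos (min_le_right _ _)]
    linarith [max_add_min (V (m + 1) (e η)) 0]
  have hcard : (γ.card : ℝ) = ∑ r ∈ γ.image c, ((γ.filter fun x => c x = r).card : ℝ) := by
    exact_mod_cast Finset.card_eq_sum_card_image c γ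
  have key : ∀ r, ((m + 1 : ℕ) : ℝ) * ((γ.filter fun x => c x = r).card : ℝ) ^ (m + 1) *
        I.toReal ≤
      ((γ.filter fun x => c x = r).card.choose (m + 1) : ℝ) * Vpp d lam V (m + 1) r +
        ((m + 1 : ℕ) : ℝ) ^ (m + 2) * I.toReal * ((γ.filter fun x => c x = r).card : ℝ) := by
    intro r
    generalize (γ.filter fun x => c x = r).card = n
    have hI0 : 0 ≤ I.toReal := ENNReal.toReal_nonneg
    rcases le_or_gt (m + 1) n with hn | hn
    · refine le_add_of_le_of_nonneg ?_ (by positivity)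
      have hch : (n : ℝ) ^ (m + 1) ≤ ((m + 1 : ℕ) : ℝ) ^ (m + 1) * (n.choose (m + 1) : ℝ) := by
        exact_mod_cast pow_le_pow_self_mul_choose (m + 1) n hn
      calc _ ≤ ((m + 1 : ℕ) : ℝ) * (((m + 1 : ℕ) : ℝ) ^ (m + 1) * (n.choose (m + 1) : ℝ)) *
              I.toReal := by gcongr
        _ = (n.choose (m + 1) : ℝ) * (((m + 1 : ℕ) : ℝ) ^ (m + 2) * I.toReal) := by ring
        _ ≤ _ := by gcongr; exact hV r
    · refine le_add_of_nonneg_of_le (mul_nonneg (Nat.cast_nonneg _) (Vpp_nonneg _ _)) ?_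
      have hn' : (n : ℝ) ≤ ((m + 1 : ℕ) : ℝ) := by exact_mod_cast hn.le
      have h1 : (1 : ℝ) ≤ ((m + 1 : ℕ) : ℝ) := by exact_mod_cast m.succ_pos
      calc _ = ((m + 1 : ℕ) : ℝ) * ((n : ℝ) ^ m * n) * I.toReal := by ring
        _ ≤ ((m + 1 : ℕ) : ℝ) * (((m + 1 : ℕ) : ℝ) ^ m * n) * I.toReal := by gcongr
        _ = ((m + 1 : ℕ) : ℝ) ^ (m + 1) * I.toReal * n := by ring
        _ ≤ _ := by gcongr; simp
  have hsum := Finset.sum_le_sum fun r (_ : r ∈ γ.image c) => key r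
  rw [Finset.sum_add_distrib, ← Finset.sum_mul, ← Finset.mul_sum, ← Finset.mul_sum,
    ← hcard] at hsum
  linarith

end Energy

theorem statement0 (d : ℕ) (hd : 1 ≤ d) (lam : ℝ) (hlam : 0 < lam)
    (V : (p : ℕ) → (Fin p → Pt d) → ℝ) (HA : ManyBodyAssumptions d lam V)
    (B₂ : ℝ) (hB₂ : 0 < B₂)
    (hstab : ∀ γ : Finset (Pt d), -B₂ * γ.card ≤ pEnergy d V 2 γ)
    (h1 : ∀ p, 2 < p → ∀ r : Fin d → ℤ,
      0 ≤ Vpp d lam V p r / (p : ℝ) ^ p - (p : ℝ) * (Ikm d lam V p 1 (p - 1) r).toReal)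
    (h2 : ∀ r : Fin d → ℤ,
      (∑' p : ℕ, if 2 < p then (p : ℝ≥0∞) ^ (p + 1) * Ikm d lam V p 1 (p - 1) r else 0) ≠ ⊤) :
    ∀ γ : Finset (Pt d),
      -(B₂ + (∑' p : ℕ,
          if 2 < p then (p : ℝ≥0∞) ^ (p + 1) * Ikm d lam V p 1 (p - 1) 0 else 0).toReal)
        * γ.card ≤ energy d V γ := by
  intro γ
  set S := ∑' p : ℕ, if 2 < p then (p : ℝ≥0∞) ^ (p + 1) * Ikm d lam V p 1 (p - 1) 0 else 0
    with hS
  have hterm : ∀ p : ℕ, 2 < p →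
      -((p : ℝ) ^ (p + 1) * (Ikm d lam V p 1 (p - 1) 0).toReal) * γ.card ≤ pEnergy d V p γ := by
    intro p hp
    have hfin : Ikm d lam V p 1 (p - 1) 0 ≠ ⊤ := by
      intro htop
      have := ENNReal.ne_top_of_tsum_ne_top (h2 0) p
      simp only [hp, if_true, htop] at this
      exact this (ENNReal.mul_top (pow_ne_zero _ (Nat.cast_ne_zero.2 (by omega))))
    have htr := fun r => Ikm_translate (lam := lam) (HA.transl p hp.le) 1 (p - 1) r
    have hV : ∀ r, (p : ℝ) ^ (p + 1) * (Ikm d lam V p 1 (p - 1) 0).toReal ≤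
        Vpp d lam V p r := by
      intro r
      have hp0 : (0 : ℝ) < (p : ℝ) ^ p := pow_pos (by exact_mod_cast (by omega : 0 < p)) p
      have h := h1 p hp r
      rw [htr r, sub_nonneg, le_div_iff₀ hp0] at h
      calc _ = _ := by ring
        _ ≤ _ := h
    obtain ⟨m, rfl⟩ : ∃ m, p = m + 1 := ⟨p - 1, by omega⟩
    exact pEnergy_ge hlam m hfin htr hV γ
  have hle : ∑ p ∈ Finset.Icc 3 γ.card,
      (p : ℝ) ^ (p + 1) * (Ikm d lam V p 1 (p - 1) 0).toReal ≤ S.toReal := by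
    have h := ENNReal.toReal_mono (h2 0) (ENNReal.sum_le_tsum (Finset.Icc 3 γ.card))
    rw [ENNReal.toReal_sum fun p _ => ENNReal.ne_top_of_tsum_ne_top (h2 0) p] at h
    refine (Finset.sum_congr rfl fun p hp => ?_).trans_le h
    rw [if_pos (by have := Finset.mem_Icc.1 hp; omega)]
    simp
  have hγ0 : (0 : ℝ) ≤ γ.card := Nat.cast_nonneg _
  rcases le_or_gt 2 γ.card with hγ | hγ
  · have hE : energy d V γ = pEnergy d V 2 γ + ∑ p ∈ Finset.Icc 3 γ.card, pEnergy d V p γ := by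
      rw [energy, ← Finset.insert_Icc_add_one_left_eq_Icc hγ, Finset.sum_insert (by simp), two_add_one_eq_three]
    have hsum := Finset.sum_le_sum fun p (hp : p ∈ Finset.Icc 3 γ.card) =>
      hterm p (by have := Finset.mem_Icc.1 hp; omega)
    rw [← Finset.sum_mul, Finset.sum_neg_distrib] at hsum
    rw [hE]
    nlinarith [hstab γ, mul_le_mul_of_nonneg_right hle hγ0]
  · rw [energy, Finset.Icc_eq_empty (by omega), Finset.sum_empty, neg_mul]
    have : 0 ≤ S.toReal := ENNReal.toReal_nonneg
    exact neg_nonpos.2 (by positivity)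
end

section
/- (Lemma 2) Let {V_p}_{p≥2} satisfy assumptions A1–A4 with respect to a partition of ℝ^d into cubes. Then for every p ≥ 2, every 2 ≤ j ≤ p, every k_1,…,k_j ≥ 1 with k_1+⋯+k_j = p, and every finite configuration γ ⊂ ℝ^d: Σ over unordered sets {Δ_1,…,Δ_j} of j pairwise distinct cubes with |γ_{Δ_r}| ≥ 1 for all r of [ Σ'_{π ∈ P_j} I_p^{k_{π(1)},…,k_{π(j)}}(Δ_1,…,Δ_j) · Σ_{i=1}^{j} |γ_{Δ_i}|^p ] ≤ j · Σ over cubes Δ with |γ_Δ| ≥ 1 of |γ_Δ|^p · I_p^{k_1 | {k_2,…,k_j}}(Δ). -/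
open MeasureTheory
open scoped ENNReal BigOperators

/-- `κ` is a finitely supported occupation function on lattice sites whose nonzero values form
the multiset `K`. -/
def HasCounts {α : Type*} (κ : α → ℕ) (K : Multiset ℕ) : Prop :=
  ∃ S : Finset α, (∀ s, κ s ≠ 0 ↔ s ∈ S) ∧ S.val.map κ = K

theorem HasCounts.comp_equiv {α : Type*} {κ : α → ℕ} {K : Multiset ℕ} (h : HasCounts κ K)
    (e : α ≃ α) : HasCounts (κ ∘ e) K := by
  obtain ⟨S, hS, hK⟩ := h
  refine ⟨S.map e.symm.toEmbedding, fun s => ?_, ?_⟩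
  · simp [hS]
  · rw [← hK, Finset.map_val, Multiset.map_map]
    exact Multiset.map_congr rfl fun s _ => by simp

theorem HasCounts.exists_eq {α : Type*} {κ : α → ℕ} {K : Multiset ℕ} (h : HasCounts κ K)
    {k : ℕ} (hk : k ∈ K) : ∃ t, κ t = k := by
  obtain ⟨S, -, rfl⟩ := h
  obtain ⟨t, -, ht⟩ := Multiset.mem_map.1 hk
  exact ⟨t, ht⟩

theorem HasCounts.card_support {α : Type*} {κ : α → ℕ} {K : Multiset ℕ} (h : HasCounts κ K) :
    ENat.card {s // κ s ≠ 0} = Multiset.card K := by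
  obtain ⟨S, hS, rfl⟩ := h
  rw [ENat.card_congr (Equiv.subtypeEquivRight hS)]
  simp

theorem HasCounts.update_zero {α : Type*} [DecidableEq α] {κ : α → ℕ} {k : ℕ} {K : Multiset ℕ}
    (h : HasCounts κ (k ::ₘ K)) {s : α} (hs : κ s = k) (hk : k ≠ 0) :
    HasCounts (Function.update κ s 0) K := by
  obtain ⟨S, hS, hK⟩ := h
  have hsS : s ∈ S := (hS s).1 (hs ▸ hk)
  refine ⟨S.erase s, fun t => ?_, ?_⟩
  · by_cases hts : t = s <;> simp [hts, hS]
  · have h1 : (S.erase s).val.map (Function.update κ s 0) = (S.erase s).val.map κ :=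
      Multiset.map_congr rfl fun t ht =>
        Function.update_of_ne (Finset.ne_of_mem_erase ht) _ _
    rw [h1]
    have h2 : S.val = s ::ₘ (S.erase s).val := by
      rw [Finset.erase_val, Multiset.cons_erase hsS]
    rw [h2, Multiset.map_cons, hs] at hK
    exact (Multiset.cons_inj_right k).1 hK

theorem mem_cube_sub (d : ℕ) (lam : ℝ) (r v : Fin d → ℤ) (x : Pt d) (hx : x ∈ cube d lam r) :
    x + WithLp.toLp 2 (fun i => -(lam * (v i : ℝ))) ∈ cube d lam (r - v) := by
  intro i
  have h := hx i
  simp only [PiLp.add_apply, Pi.sub_apply, Int.cast_sub]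
  constructor <;> linarith [h.1, h.2]

theorem IblocksF_le_comp_add {d : ℕ} {lam : ℝ} {V : (p : ℕ) → (Fin p → Pt d) → ℝ}
    (HA : ManyBodyAssumptions d lam V) {p : ℕ} (hp : 2 ≤ p) (κ : (Fin d → ℤ) → ℕ)
    (v : Fin d → ℤ) :
    IblocksF d lam V p κ ≤ IblocksF d lam V p (κ ∘ Equiv.addRight v) := by
  refine iSup₂_le fun x ⟨c, hc, hκ⟩ => ?_
  rw [← HA.transl p hp x (WithLp.toLp 2 (fun i => -(lam * (v i : ℝ))))]
  refine le_iSup₂_of_le _ ⟨fun i => c i - v, fun i => mem_cube_sub d lam _ v _ (hc i),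
    fun s => ?_⟩ le_rfl
  simp only [sub_eq_iff_eq_add, Function.comp_apply, Equiv.coe_addRight, hκ]

/-- Averaging over translations: for a translation invariant weight, the configurations with a
nonempty block at `s` are at most `card K` times those with a block of size `k` at `s`. -/
theorem tsum_hasCounts_le {G : Type*} [AddCommGroup G] (I : (G → ℕ) → ℝ≥0∞)
    (hI : ∀ κ v, I κ ≤ I (κ ∘ Equiv.addRight v)) {K : Multiset ℕ} {k : ℕ} (hk : k ∈ K) (s : G) :
    ∑' κ : {κ : G → ℕ // HasCounts κ K ∧ κ s ≠ 0}, I κ.1 ≤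
      (Multiset.card K : ℝ≥0∞) * ∑' κ : {κ : G → ℕ // HasCounts κ K ∧ κ s = k}, I κ.1 := by
  choose t ht using fun κ : {κ : G → ℕ // HasCounts κ K ∧ κ s ≠ 0} => κ.2.1.exists_eq hk
  let f : {κ : G → ℕ // HasCounts κ K ∧ κ s ≠ 0} →
      Σ κ : {κ : G → ℕ // HasCounts κ K ∧ κ s = k}, {u // κ.1 u ≠ 0} := fun κ =>
    ⟨⟨κ.1 ∘ Equiv.addRight (t κ - s), κ.2.1.comp_equiv _, by simp [ht]⟩,
      ⟨s - (t κ - s), by simpa using κ.2.2⟩⟩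
  have hf : Function.Injective f := by
    intro κ κ' h
    have h1 : κ.1 ∘ Equiv.addRight (t κ - s) = κ'.1 ∘ Equiv.addRight (t κ' - s) :=
      congrArg (fun z => z.1.1) h
    have h2 : s - (t κ - s) = s - (t κ' - s) := congrArg (fun z => z.2.1) h
    rw [sub_right_inj.1 h2] at h1
    exact Subtype.ext ((Equiv.surjective _).injective_comp_right h1)
  calc ∑' κ : {κ : G → ℕ // HasCounts κ K ∧ κ s ≠ 0}, I κ.1
      ≤ ∑' κ, I (f κ).1.1 := ENNReal.tsum_le_tsum fun κ => hI _ _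
    _ ≤ ∑' z : Σ κ : {κ : G → ℕ // HasCounts κ K ∧ κ s = k}, {u // κ.1 u ≠ 0}, I z.1.1 :=
        ENNReal.tsum_comp_le_tsum_of_injective hf fun z => I z.1.1
    _ = _ := by
        rw [ENNReal.tsum_sigma', ← ENNReal.tsum_mul_left]
        refine tsum_congr fun κ => ?_
        change ∑' _ : {u // κ.1 u ≠ 0}, I κ.1 = _
        rw [ENNReal.tsum_const, κ.2.1.card_support]
        simp

theorem tsum_hasCounts_le_IpartSet (d : ℕ) (lam : ℝ) (V : (p : ℕ) → (Fin p → Pt d) → ℝ) (p : ℕ)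
    {k : ℕ} (hk : k ≠ 0) (K : Multiset ℕ) (s : Fin d → ℤ) :
    ∑' κ : {κ : (Fin d → ℤ) → ℕ // HasCounts κ (k ::ₘ K) ∧ κ s = k}, IblocksF d lam V p κ.1 ≤
      IpartSet d lam V p k K s := by
  let f : {κ : (Fin d → ℤ) → ℕ // HasCounts κ (k ::ₘ K) ∧ κ s = k} →
      {κ : (Fin d → ℤ) → ℕ // κ s = 0 ∧ HasCounts κ K} := fun κ =>
    ⟨Function.update κ.1 s 0, by simp, κ.2.1.update_zero κ.2.2 hk⟩
  have hfk : ∀ κ, Function.update (f κ).1 s k = κ.1 := fun κ => by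
    rw [Function.update_idem, Function.update_eq_self_iff, κ.2.2]
  have hf : Function.Injective f := fun κ κ' h => Subtype.ext <| by
    rw [← hfk κ, ← hfk κ', h]
  calc _ = ∑' κ, IblocksF d lam V p (Function.update (f κ).1 s k) := by simp only [hfk]
    _ ≤ _ := ENNReal.tsum_comp_le_tsum_of_injective hf fun κ =>
        IblocksF d lam V p (Function.update κ.1 s k)

/-- Exchanging the sum over configurations with the sum over the sites of their support. -/
theorem tsum_mul_sum_support_le {α : Type*} (I : (α → ℕ) → ℝ≥0∞) (K : Multiset ℕ) (n : α → ℕ)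
    (w : α → ℝ≥0∞) :
    ∑' q : {q : Finset α × (α → ℕ) //
        (∀ s, q.2 s ≠ 0 ↔ s ∈ q.1) ∧ q.1.val.map q.2 = K ∧ ∀ s ∈ q.1, 1 ≤ n s},
      I q.1.2 * ∑ s ∈ q.1.1, w s
    ≤ ∑' s, (if 1 ≤ n s then w s else 0) *
        ∑' κ : {κ : α → ℕ // HasCounts κ K ∧ κ s ≠ 0}, I κ.1 := by
  let Q := {q : Finset α × (α → ℕ) //
        (∀ s, q.2 s ≠ 0 ↔ s ∈ q.1) ∧ q.1.val.map q.2 = K ∧ ∀ s ∈ q.1, 1 ≤ n s}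
  let f : (Σ q : Q, {s // s ∈ q.1.1}) → Σ s, {κ : α → ℕ // HasCounts κ K ∧ κ s ≠ 0} := fun z =>
    ⟨z.2.1, z.1.1.2, ⟨z.1.1.1, z.1.2.1, z.1.2.2.1⟩, (z.1.2.1 _).2 z.2.2⟩
  have hf : Function.Injective f := by
    rintro ⟨⟨⟨S, κ⟩, hq⟩, s, hs⟩ ⟨⟨⟨S', κ'⟩, hq'⟩, s', hs'⟩ h
    obtain rfl : s = s' := congrArg (fun z => z.1) h
    obtain rfl : κ = κ' := congrArg (fun z : Σ s, {κ : α → ℕ // HasCounts κ K ∧ κ s ≠ 0} =>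
      z.2.1) h
    obtain rfl : S = S' := Finset.ext fun s => (hq.1 s).symm.trans (hq'.1 s)
    rfl
  let g : (Σ s, {κ : α → ℕ // HasCounts κ K ∧ κ s ≠ 0}) → ℝ≥0∞ := fun z =>
    (if 1 ≤ n z.1 then w z.1 else 0) * I z.2.1
  calc _ = ∑' z : Σ q : Q, {s // s ∈ q.1.1}, g (f z) := by
        rw [ENNReal.tsum_sigma']
        refine tsum_congr fun q => ?_
        rw [Finset.mul_sum, ← Finset.tsum_subtype]
        refine tsum_congr fun s => ?_
        change I q.1.2 * w s.1 = (if 1 ≤ n s.1 then w s.1 else 0) * I q.1.2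
        rw [if_pos (q.2.2.2 s.1 s.2), mul_comm]
    _ ≤ ∑' z, g z := ENNReal.tsum_comp_le_tsum_of_injective hf g
    _ = _ := by
        rw [ENNReal.tsum_sigma']
        refine tsum_congr fun s => ?_
        rw [← ENNReal.tsum_mul_left]

theorem statement4 (d : ℕ) (lam : ℝ) (hlam : 0 < lam)
    (V : (p : ℕ) → (Fin p → Pt d) → ℝ) (HA : ManyBodyAssumptions d lam V)
    (p : ℕ) (hp : 2 ≤ p) (j : ℕ) (hj2 : 2 ≤ j) (hjp : j ≤ p)
    (l : List ℕ) (hlen : l.length = j) (hpos : ∀ k ∈ l, 1 ≤ k) (hsum : l.sum = p)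
    (γ : Finset (Pt d)) :
    ∑' q : {q : Finset (Fin d → ℤ) × ((Fin d → ℤ) → ℕ) //
        (∀ s, q.2 s ≠ 0 ↔ s ∈ q.1) ∧ q.1.val.map q.2 = (l : Multiset ℕ) ∧
        ∀ s ∈ q.1, 1 ≤ occupancy d lam γ s},
      IblocksF d lam V p q.1.2 * ∑ s ∈ q.1.1, (occupancy d lam γ s : ℝ≥0∞) ^ p
    ≤ (j : ℝ≥0∞) * ∑' r : Fin d → ℤ,
        (if 1 ≤ occupancy d lam γ r then (occupancy d lam γ r : ℝ≥0∞) ^ p else 0) *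
          IpartSet d lam V p l.headI ((l.tail : List ℕ) : Multiset ℕ) r := by
  obtain _ | ⟨k, t⟩ := l
  · simp only [List.length_nil] at hlen
    omega
  have hk : k ≠ 0 := by
    have := hpos k (by simp)
    omega
  refine (tsum_mul_sum_support_le (IblocksF d lam V p) _ (occupancy d lam γ) _).trans ?_
  rw [← ENNReal.tsum_mul_left]
  refine ENNReal.tsum_le_tsum fun s => ?_
  rw [mul_left_comm]
  gcongr
  refine (tsum_hasCounts_le (IblocksF d lam V p) (IblocksF_le_comp_add HA hp)
    (k := k) (by simp) s).trans ?_
  rw [Multiset.coe_card, hlen]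
  gcongr
  exact tsum_hasCounts_le_IpartSet d lam V p hk t s
end

section
/- For any p ≥ 2 and any points x_1,…,x_p ∈ ℝ^d: Σ_{1 ≤ i < j ≤ p} |x_i − x_j| ≥ (p − 1) · max_{1 ≤ i < j ≤ p} |x_i − x_j|. -/
open MeasureTheory
open scoped ENNReal BigOperators

/-- The sum of the distances over all ordered pairs from a finite family of points is at least
`2 (n - 1)` times the distance between any two of them. -/
theorem two_mul_card_sub_one_mul_dist_le_sum_sum_dist {ι X : Type*} [Fintype ι]
    [PseudoMetricSpace X] (x : ι → X) (a b : ι) :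
    2 * ((Fintype.card ι : ℝ) - 1) * dist (x a) (x b) ≤ ∑ i, ∑ j, dist (x i) (x j) := by
  classical
  obtain rfl | hab := eq_or_ne a b
  · simpa using Finset.sum_nonneg fun i _ => Finset.sum_nonneg fun j _ => dist_nonneg
  have htriangle (i : ι) : dist (x a) (x b) ≤ dist (x a) (x i) + dist (x b) (x i) := by
    simpa [dist_comm (x b)] using dist_triangle (x a) (x i) (x b)
  have hrow (i : ι) : dist (x a) (x b) ≤ ∑ j, dist (x i) (x j) := calc
    dist (x a) (x b) ≤ dist (x i) (x a) + dist (x i) (x b) := dist_triangle_left _ _ _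
    _ = ∑ j ∈ {a, b}, dist (x i) (x j) := by rw [Finset.sum_pair hab]
    _ ≤ ∑ j, dist (x i) (x j) :=
      Finset.sum_le_sum_of_subset_of_nonneg (Finset.subset_univ _) fun _ _ _ => dist_nonneg
  have hends : (Fintype.card ι : ℝ) * dist (x a) (x b) ≤
      ∑ i ∈ {a, b}, ∑ j, dist (x i) (x j) := by
    rw [Finset.sum_pair hab, ← Finset.sum_add_distrib, ← nsmul_eq_mul, ← Finset.card_univ]
    exact Finset.card_nsmul_le_sum _ _ _ fun i _ => htriangle i
  have hrest : ((Fintype.card ι : ℝ) - 2) * dist (x a) (x b) ≤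
      ∑ i ∈ {a, b}ᶜ, ∑ j, dist (x i) (x j) := by
    have hcard : (({a, b}ᶜ : Finset ι).card : ℝ) = (Fintype.card ι : ℝ) - 2 := by
      have h := Finset.card_add_card_compl ({a, b} : Finset ι)
      rw [Finset.card_pair hab] at h
      rw [← h]
      push_cast
      ring
    rw [← hcard, ← nsmul_eq_mul]
    exact Finset.card_nsmul_le_sum _ _ _ fun i _ => hrow i
  rw [← Finset.sum_add_sum_compl {a, b}]
  linarith

/-- For a symmetric function vanishing on the diagonal, the sum over all ordered pairs is twice
the sum over the pairs `i < j`. -/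
theorem sum_sum_eq_two_mul_sum_pairs {p : ℕ} (f : Fin p → Fin p → ℝ)
    (hsymm : ∀ i j, f i j = f j i) (hdiag : ∀ i, f i i = 0) :
    ∑ i, ∑ j, f i j = 2 * ∑ q ∈ pairs p, f q.1 q.2 := by
  have hpairs : ∑ q ∈ pairs p, f q.1 q.2 = ∑ i, ∑ j, if i < j then f i j else 0 := by
    rw [pairs, Finset.sum_filter, Fintype.sum_prod_type]
  have hswap : ∑ q ∈ pairs p, f q.1 q.2 = ∑ i, ∑ j, if j < i then f j i else 0 := by
    rw [hpairs, Finset.sum_comm]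
  rw [two_mul]
  nth_rewrite 1 [hpairs]
  rw [hswap]
  simp only [← Finset.sum_add_distrib]
  refine Finset.sum_congr rfl fun i _ => Finset.sum_congr rfl fun j _ => ?_
  rcases lt_trichotomy i j with h | rfl | h
  · simp [h, h.not_gt]
  · simp [hdiag]
  · simp [h, h.not_gt, hsymm i j]

theorem statement7 (d : ℕ) (p : ℕ) (hp : 2 ≤ p) (x : Fin p → Pt d) :
    ((p : ℝ) - 1) *
        (pairs p).sup'
          ⟨(⟨0, by omega⟩, ⟨1, by omega⟩),
            Finset.mem_filter.mpr ⟨Finset.mem_univ _, Fin.mk_lt_mk.mpr Nat.zero_lt_one⟩⟩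
          (fun q => dist (x q.1) (x q.2))
      ≤ ∑ q ∈ pairs p, dist (x q.1) (x q.2) := by
  obtain ⟨q, -, hq⟩ := Finset.exists_mem_eq_sup' (s := pairs p)
    ⟨(⟨0, by omega⟩, ⟨1, by omega⟩),
      Finset.mem_filter.mpr ⟨Finset.mem_univ _, Fin.mk_lt_mk.mpr Nat.zero_lt_one⟩⟩
    (fun q => dist (x q.1) (x q.2))
  rw [hq]
  have h := two_mul_card_sub_one_mul_dist_le_sum_sum_dist x q.1 q.2
  rw [sum_sum_eq_two_mul_sum_pairs (fun i j => dist (x i) (x j)) (fun _ _ => dist_comm _ _)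
    (fun _ => dist_self _), Fintype.card_fin] at h
  linarith
end

section
/- For any p ≥ 2 and any points x_1,…,x_p ∈ ℝ (dimension d = 1): Σ_{1 ≤ i < j ≤ p} |x_i − x_j| ≤ (p − ⌊p/2⌋) · ⌊p/2⌋ · max_{1 ≤ i < j ≤ p} |x_i − x_j|, where ⌊p/2⌋ is the integer part of p/2. -/
open MeasureTheory
open scoped ENNReal BigOperators

/-- Among finitely many reals at mutual distance at most `D`, the sum of the distances over all
ordered pairs is at most `2 (n - ⌊n/2⌋) ⌊n/2⌋ D`, where `n` is the number of points. -/
theorem sum_sum_abs_sub_le {ι : Type*} (x : ι → ℝ) (D : ℝ) (s : Finset ι)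
    (hD : ∀ i ∈ s, ∀ j ∈ s, |x i - x j| ≤ D) :
    ∑ i ∈ s, ∑ j ∈ s, |x i - x j| ≤ 2 * ((s.card - s.card / 2) * (s.card / 2) : ℕ) * D := by
  classical
  induction hn : s.card using Nat.strong_induction_on generalizing s with
  | _ n ih =>
  rcases Nat.lt_or_ge n 2 with h2 | h2
  · have hle : s.card ≤ 1 := by omega
    have h0 : ∑ i ∈ s, ∑ j ∈ s, |x i - x j| = 0 :=
      Finset.sum_eq_zero fun i hi => Finset.sum_eq_zero fun j hj => by
        simp [Finset.card_le_one.mp hle i hi j hj]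
    have hhalf : n / 2 = 0 := by omega
    simp [h0, hhalf]
  -- Remove a leftmost and a rightmost point.
  obtain ⟨a, ha, hmin⟩ := s.exists_min_image x (Finset.card_pos.mp (by omega))
  have hca : (s.erase a).card = n - 1 := by rw [Finset.card_erase_of_mem ha, hn]
  obtain ⟨b, hb, hmax⟩ := (s.erase a).exists_max_image x (Finset.card_pos.mp (by omega))
  set t := (s.erase a).erase b
  have hct : t.card = n - 2 := by rw [Finset.card_erase_of_mem hb, hca]; omega
  have hts : t ⊆ s := (Finset.erase_subset _ _).trans (Finset.erase_subset _ _)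
  have hbs : b ∈ s := Finset.mem_of_mem_erase hb
  have hab : |x a - x b| ≤ D := hD a ha b hbs
  have hIH := ih (n - 2) (by omega) t (fun i hi j hj => hD i (hts hi) j (hts hj)) hct
  have split (f : ι → ℝ) : ∑ i ∈ s, f i = f a + (f b + ∑ i ∈ t, f i) := by
    rw [← Finset.add_sum_erase s f ha, ← Finset.add_sum_erase _ f hb]
  have hcross : ∑ i ∈ t, |x a - x i| + ∑ i ∈ t, |x b - x i| ≤ ((n - 2 : ℕ) : ℝ) * D := by
    rw [← Finset.sum_add_distrib, ← hct, ← nsmul_eq_mul]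
    refine Finset.sum_le_card_nsmul _ _ _ fun i hi => ?_
    have h1 := hmin i (hts hi)
    have h2 := hmax i (Finset.mem_of_mem_erase hi)
    have h3 := neg_le_abs (x a - x b)
    rw [abs_of_nonpos (by linarith), abs_of_nonneg (by linarith)]
    linarith
  have hcount : (n - n / 2) * (n / 2)
      = (n - 2 - (n - 2) / 2) * ((n - 2) / 2) + (n - 2) + 1 := by
    obtain ⟨m, rfl⟩ := Nat.exists_eq_add_of_le' h2
    have e1 : (m + 2) / 2 = m / 2 + 1 := by omega
    have e2 : m + 2 - (m / 2 + 1) = m - m / 2 + 1 := by omega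
    have e3 : m - m / 2 + m / 2 = m := by omega
    rw [Nat.add_sub_cancel, e1, e2]
    linarith [e3, add_one_mul (m - m / 2) (m / 2 + 1), mul_add_one (m - m / 2) (m / 2)]
  have htotal : ∑ i ∈ s, ∑ j ∈ s, |x i - x j|
      = 2 * |x a - x b| + 2 * (∑ i ∈ t, |x a - x i| + ∑ i ∈ t, |x b - x i|)
        + ∑ i ∈ t, ∑ j ∈ t, |x i - x j| := by
    have comm (c : ι) : ∑ i ∈ t, |x i - x c| = ∑ i ∈ t, |x c - x i| :=
      Finset.sum_congr rfl fun i _ => abs_sub_comm _ _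
    simp only [split, Finset.sum_add_distrib, sub_self, abs_zero, comm, abs_sub_comm (x b) (x a)]
    ring
  rw [htotal, hcount]
  push_cast at hIH hcross ⊢
  linarith

/-- Summing over all ordered pairs counts every distance twice. -/
theorem two_mul_pairSum (p : ℕ) (x : Fin p → ℝ) :
    2 * pairSum p x = ∑ i, ∑ j, |x i - x j| := by
  have h1 : pairSum p x = ∑ i, ∑ j, if i < j then |x i - x j| else 0 := by
    rw [pairSum, pairs, Finset.sum_filter, Fintype.sum_prod_type]
  have h2 : pairSum p x = ∑ i, ∑ j, if j < i then |x i - x j| else 0 := by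
    rw [h1, Finset.sum_comm]
    simp only [abs_sub_comm]
  rw [two_mul]
  nth_rw 1 [h1]
  rw [h2]
  simp only [← Finset.sum_add_distrib]
  refine Finset.sum_congr rfl fun i _ => Finset.sum_congr rfl fun j _ => ?_
  rcases lt_trichotomy i j with h | h | h
  · simp [h, h.not_gt]
  · simp [h]
  · simp [h, h.not_gt]

theorem statement8 (p : ℕ) (hp : 2 ≤ p) (x : Fin p → ℝ) :
    pairSum p x
      ≤ ((p - p / 2) * (p / 2) : ℕ) *
          (pairs p).sup'
            ⟨(⟨0, by omega⟩, ⟨1, by omega⟩),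
              Finset.mem_filter.mpr ⟨Finset.mem_univ _, Fin.mk_lt_mk.mpr Nat.zero_lt_one⟩⟩
            (fun q => |x q.1 - x q.2|) := by
  have hne : (pairs p).Nonempty :=
    ⟨(⟨0, by omega⟩, ⟨1, by omega⟩),
      Finset.mem_filter.mpr ⟨Finset.mem_univ _, Fin.mk_lt_mk.mpr Nat.zero_lt_one⟩⟩
  change _ ≤ _ * (pairs p).sup' hne _
  generalize hDdef : (pairs p).sup' hne (fun q => |x q.1 - x q.2|) = D
  have hlt (i j : Fin p) (h : i < j) : |x i - x j| ≤ D := by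
    rw [← hDdef]
    exact Finset.le_sup' (fun q : Fin p × Fin p => |x q.1 - x q.2|)
      (Finset.mem_filter.mpr ⟨Finset.mem_univ (i, j), h⟩)
  have hD (i j : Fin p) : |x i - x j| ≤ D := by
    rcases lt_trichotomy i j with h | rfl | h
    · exact hlt i j h
    · rw [sub_self, abs_zero]
      exact (abs_nonneg _).trans
        (hlt ⟨0, by omega⟩ ⟨1, by omega⟩ (Fin.mk_lt_mk.mpr Nat.zero_lt_one))
    · rw [abs_sub_comm]
      exact hlt j i h
  have h := sum_sum_abs_sub_le x D Finset.univ fun i _ j _ => hD i j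
  rw [← two_mul_pairSum, Finset.card_univ, Fintype.card_fin] at h
  linarith
end

section
/- Let d = 1 and for p ≥ 2 define V_p(x_1,…,x_p) = A_p / S^{m(p)} − B_p / S^{n(p)}, where S = Σ_{1≤i<j≤p} |x_i − x_j|, with constants A_p > 0, B_p > 0 and exponents m(p) > n(p), n(p) > p − 1. Then the integrability assumption A4 holds; in particular the integral I_p = ∫_{ℝ^{p−1}} |V_p^−(x_1, x_2, …, x_p)| dx_2 ⋯ dx_p is finite (and by translation invariance does not depend on x_1). -/
open MeasureTheory
open scoped ENNReal BigOperators

/-- The example `p`-body potential `V_p(x) = A/S^m - B/S^n`, `S = Σ_{i<j}|x_i - x_j|`. -/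
noncomputable def Vexample (p : ℕ) (A B m n : ℝ) (x : Fin p → ℝ) : ℝ :=
  A / pairSum p x ^ m - B / pairSum p x ^ n

theorem abs_sub_le_pairSum {p : ℕ} (x : Fin p → ℝ) {i j : Fin p} (hij : i < j) :
    |x i - x j| ≤ pairSum p x :=
  Finset.single_le_sum (f := fun q : Fin p × Fin p => |x q.1 - x q.2|)
    (fun _ _ => abs_nonneg _) (show (i, j) ∈ pairs p by simpa [pairs] using hij)

theorem pairSum_nonneg (p : ℕ) (x : Fin p → ℝ) : 0 ≤ pairSum p x :=
  Finset.sum_nonneg fun _ _ => abs_nonneg _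

theorem norm_sub_const_le_pairSum_joinAt {p k : ℕ} (hk : 0 < k) (h : k ≤ p)
    (y : Fin k → ℝ) (z : Fin (p - k) → ℝ) :
    ‖z - fun _ => y ⟨0, hk⟩‖ ≤ pairSum p (joinAt p k h y z) := by
  rw [pi_norm_le_iff_of_nonneg (pairSum_nonneg _ _)]
  intro j
  have hlt : (⟨0, by omega⟩ : Fin p) < ⟨k + j, by omega⟩ := Fin.mk_lt_mk.2 (by omega)
  have h0 : joinAt p k h y z ⟨0, by omega⟩ = y ⟨0, hk⟩ :=
    Fin.append_left y z ⟨0, hk⟩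
  have hj : joinAt p k h y z ⟨k + j, by omega⟩ = z j :=
    Fin.append_right y z j
  have := abs_sub_le_pairSum (joinAt p k h y z) hlt
  rw [h0, hj, abs_sub_comm] at this
  simpa [Real.norm_eq_abs] using this

/-- The negative part of `A / s ^ m - B / s ^ n` is supported away from `s = 0` and decays like
`s ^ (-n)`. -/
theorem exists_abs_min_div_rpow_sub_le {A B m n : ℝ} (hA : 0 < A) (hB : 0 < B) (hn : 0 < n)
    (hmn : n < m) :
    ∃ C : ℝ, 0 ≤ C ∧ ∀ s t : ℝ, 0 ≤ t → t ≤ s →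
      |min (A / s ^ m - B / s ^ n) 0| ≤ C * (1 + t) ^ (-n) := by
  set s₀ : ℝ := (A / B) ^ (1 / (m - n)) with hs₀_def
  have hAB : 0 < A / B := div_pos hA hB
  have hs₀ : 0 < s₀ := Real.rpow_pos_of_pos hAB _
  set c : ℝ := s₀ / (1 + s₀) with hc_def
  have hc : 0 < c := by positivity
  refine ⟨B / c ^ n, by positivity, fun s t ht hts => ?_⟩
  have hnn : 0 ≤ B / c ^ n * (1 + t) ^ (-n) := by positivity
  rcases le_or_gt 0 (A / s ^ m - B / s ^ n) with hV | hV
  · simpa [min_eq_right hV] using hnn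
  rw [min_eq_left hV.le, abs_of_neg hV]
  have hs : 0 < s := by
    rcases (ht.trans hts).eq_or_lt with h | h
    · simp [← h, Real.zero_rpow hn.ne', Real.zero_rpow (hn.trans hmn).ne'] at hV
    · exact h
  have hsn : 0 < s ^ n := Real.rpow_pos_of_pos hs n
  have hsm : 0 < s ^ m := Real.rpow_pos_of_pos hs m
  have hlt : A / B < s ^ (m - n) := by
    have h := sub_neg.1 hV
    rw [div_lt_div_iff₀ hsm hsn] at h
    rw [Real.rpow_sub hs, div_lt_div_iff₀ hB hsn]
    linarith
  have hs₀s : s₀ ≤ s := by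
    have h : s₀ ^ (m - n) = A / B := by
      rw [hs₀_def, ← Real.rpow_mul hAB.le, one_div_mul_cancel (sub_pos.2 hmn).ne', Real.rpow_one]
    rw [← h] at hlt
    exact ((Real.rpow_lt_rpow_iff hs₀.le hs.le (sub_pos.2 hmn)).1 hlt).le
  have hcs : c * (1 + t) ≤ s := by
    rw [hc_def, div_mul_eq_mul_div, div_le_iff₀ (by positivity)]
    nlinarith
  calc -(A / s ^ m - B / s ^ n) ≤ B / s ^ n := by
        have : 0 < A / s ^ m := div_pos hA hsm
        linarith
    _ ≤ B / (c * (1 + t)) ^ n := by gcongr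
    _ = B / c ^ n * (1 + t) ^ (-n) := by
        rw [Real.mul_rpow hc.le (by positivity), Real.rpow_neg (by positivity), div_mul_eq_div_div,
          div_eq_mul_inv (B / c ^ n)]

theorem statement11 (p : ℕ) (hp : 2 ≤ p) (A B : ℝ) (hA : 0 < A) (hB : 0 < B)
    (m n : ℝ) (hmn : n < m) (hn : (p : ℝ) - 1 < n) :
    ∀ k, 1 ≤ k → ∀ _hk2 : k ≤ p - 1,
      (⨆ y : Fin k → ℝ, ∫⁻ z : Fin (p - k) → ℝ,
          ENNReal.ofReal
            |min (Vexample p A B m n (joinAt p k (by omega) y z)) 0|) < ⊤ := by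
  intro k hk1 hk2
  have hp' : (2 : ℝ) ≤ p := by exact_mod_cast hp
  obtain ⟨C, hC, hbound⟩ := exists_abs_min_div_rpow_sub_le hA hB (by linarith) hmn
  have hdim : (Module.finrank ℝ (Fin (p - k) → ℝ) : ℝ) < n := by
    have h : ((p - k : ℕ) : ℝ) + 1 ≤ p := by exact_mod_cast (by omega : p - k + 1 ≤ p)
    rw [Module.finrank_fin_fun]
    linarith
  have hfin := finite_integral_one_add_norm (μ := (volume : Measure (Fin (p - k) → ℝ))) hdim
  refine lt_of_le_of_lt (iSup_le fun y => ?_) (ENNReal.mul_lt_top (ENNReal.ofReal_lt_top (r := C)) hfin)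
  calc
    _ ≤ ∫⁻ z : Fin (p - k) → ℝ, ENNReal.ofReal C *
          ENNReal.ofReal ((1 + ‖z - fun _ => y ⟨0, hk1⟩‖) ^ (-n)) := by
        refine lintegral_mono fun z => ?_
        rw [← ENNReal.ofReal_mul hC]
        exact ENNReal.ofReal_le_ofReal (hbound _ _ (norm_nonneg _)
          (norm_sub_const_le_pairSum_joinAt hk1 (by omega) y z))
    _ = ENNReal.ofReal C * ∫⁻ z : Fin (p - k) → ℝ, ENNReal.ofReal ((1 + ‖z‖) ^ (-n)) := by
        rw [lintegral_const_mul' _ _ ENNReal.ofReal_ne_top, lintegral_sub_right_eq_self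
          (fun z : Fin (p - k) → ℝ => ENNReal.ofReal ((1 + ‖z‖) ^ (-n)))]
end

section
/- Let d = 1 and for p ≥ 2 set V_p(x_1,…,x_p) = A_p / S^{p+1} − B_p / S^{p}, where S = Σ_{1≤i<j≤p} |x_i − x_j|, with A_p = ((p − ⌊p/2⌋)·⌊p/2⌋)^{p+1} and 0 < B_p < p^{(p−4)/2 − ε} / 2^{(2p−1)/2} for some fixed ε > 0. Let I_p = ∫_{ℝ^{p−1}} |V_p^−(x_1, x_2,…,x_p)| dx_2⋯dx_p (independent of x_1 by translation invariance). Then the series Σ_{p≥2} p^{p+1} I_p converges. -/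
open MeasureTheory
open scoped ENNReal BigOperators

theorem integrableOn_inv_max_sq {R c : ℝ} (hR : 0 < R) (hc : 0 < c) :
    IntegrableOn (fun y : ℝ => 1 / max R (c * y) ^ 2) (Set.Ioi 0) ∧
      ∫ y in Set.Ioi (0 : ℝ), 1 / max R (c * y) ^ 2 = 2 / (R * c) := by
  have hr : 0 < R / c := div_pos hR hc
  have hnear : Set.EqOn (fun _ : ℝ => 1 / R ^ 2) (fun y : ℝ => 1 / max R (c * y) ^ 2)
      (Set.Ioc 0 (R / c)) := by
    intro y hy
    have : c * y ≤ R := by rw [mul_comm]; exact (le_div_iff₀ hc).1 hy.2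
    simp only [max_eq_left this]
  have hfar : Set.EqOn (fun y : ℝ => 1 / c ^ 2 * y ^ (-2 : ℝ))
      (fun y : ℝ => 1 / max R (c * y) ^ 2) (Set.Ioi (R / c)) := by
    intro y hy
    have hy0 : 0 < y := hr.trans hy
    have : R ≤ c * y := by rw [mul_comm]; exact ((div_lt_iff₀ hc).1 hy).le
    simp only [max_eq_right this]
    rw [Real.rpow_neg hy0.le, Real.rpow_two]
    field_simp
  have hi1 : IntegrableOn (fun y : ℝ => 1 / max R (c * y) ^ 2) (Set.Ioc 0 (R / c)) :=
    (integrableOn_const (by simp)).congr_fun hnear measurableSet_Ioc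
  have hi2 : IntegrableOn (fun y : ℝ => 1 / max R (c * y) ^ 2) (Set.Ioi (R / c)) :=
    IntegrableOn.congr_fun ((integrableOn_Ioi_rpow_of_lt (by norm_num) hr).const_mul _) hfar
      measurableSet_Ioi
  rw [← Set.Ioc_union_Ioi_eq_Ioi hr.le]
  refine ⟨hi1.union hi2, ?_⟩
  rw [setIntegral_union Set.Ioc_disjoint_Ioi_same measurableSet_Ioi hi1 hi2,
    ← setIntegral_congr_fun measurableSet_Ioc hnear,
    ← setIntegral_congr_fun measurableSet_Ioi hfar, integral_const_mul,
    integral_Ioi_rpow_of_lt (by norm_num) hr, setIntegral_const, Real.volume_real_Ioc_of_le hr.le]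
  norm_num [Real.rpow_neg_one]
  field_simp
  norm_num

theorem integrableOn_pow_mul_inv_max_pow {R c : ℝ} (hR : 0 < R) (hc : 0 < c) {n : ℕ}
    (hn : 1 ≤ n) :
    IntegrableOn (fun y : ℝ => y ^ (n - 1) • (1 / max R (c * y) ^ (n + 1))) (Set.Ioi 0) ∧
      ∫ y in Set.Ioi (0 : ℝ), y ^ (n - 1) • (1 / max R (c * y) ^ (n + 1)) ≤
        2 / (R * c ^ n) := by
  obtain ⟨m, rfl⟩ := Nat.exists_eq_add_of_le' hn
  obtain ⟨hi, hI⟩ := integrableOn_inv_max_sq hR hc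
  have hle : ∀ y ∈ Set.Ioi (0 : ℝ), y ^ (m + 1 - 1) • (1 / max R (c * y) ^ (m + 1 + 1)) ≤
      1 / c ^ m * (1 / max R (c * y) ^ 2) := by
    intro y hy
    have hM : 0 < max R (c * y) := lt_max_of_lt_left hR
    have hpow : (c * y) ^ m ≤ max R (c * y) ^ m :=
      pow_le_pow_left₀ (mul_nonneg hc.le (le_of_lt hy)) (le_max_right _ _) m
    rw [mul_pow] at hpow
    rw [smul_eq_mul, Nat.add_sub_cancel, ← mul_div_assoc, mul_one, ← mul_div_assoc, mul_one,
      div_div, div_le_div_iff₀ (by positivity) (by positivity)]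
    calc y ^ m * (c ^ m * max R (c * y) ^ 2) = (c ^ m * y ^ m) * max R (c * y) ^ 2 := by ring
      _ ≤ max R (c * y) ^ m * max R (c * y) ^ 2 := by gcongr
      _ = 1 * max R (c * y) ^ (m + 1 + 1) := by ring
  have hnonneg : ∀ y ∈ Set.Ioi (0 : ℝ),
      0 ≤ y ^ (m + 1 - 1) • (1 / max R (c * y) ^ (m + 1 + 1)) := by
    intro y hy
    have hM : 0 < max R (c * y) := lt_max_of_lt_left hR
    have hy : 0 < y := hy
    rw [smul_eq_mul]
    positivity
  have hint : IntegrableOn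
      (fun y : ℝ => y ^ (m + 1 - 1) • (1 / max R (c * y) ^ (m + 1 + 1))) (Set.Ioi 0) := by
    refine Integrable.mono' (hi.const_mul (1 / c ^ m))
      (Measurable.aestronglyMeasurable (by fun_prop)) ?_
    filter_upwards [ae_restrict_mem measurableSet_Ioi] with y hy
    rw [Real.norm_of_nonneg (hnonneg y hy)]
    exact hle y hy
  refine ⟨hint, (setIntegral_mono_on hint (hi.const_mul _) measurableSet_Ioi hle).trans ?_⟩
  rw [integral_const_mul, hI, pow_succ]
  apply le_of_eq
  field_simp

theorem lintegral_inv_max_norm_pow_le {R c b : ℝ} (hR : 0 < R) (hc : 0 < c) (hb : 0 ≤ b)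
    {n : ℕ} (hn : 1 ≤ n) :
    ∫⁻ z : Fin n → ℝ, ENNReal.ofReal (b / max R (c * ‖z‖) ^ (n + 1)) ≤
      ENNReal.ofReal (b * (n * 2 ^ n * (2 / (R * c ^ n)))) := by
  have : Nonempty (Fin n) := ⟨⟨0, hn⟩⟩
  obtain ⟨hi, hI⟩ := integrableOn_pow_mul_inv_max_pow hR hc hn
  have hint : Integrable (fun z : Fin n → ℝ => 1 / max R (c * ‖z‖) ^ (n + 1)) := by
    rw [integrable_fun_norm_addHaar (volume : Measure (Fin n → ℝ))
      (f := fun y => 1 / max R (c * y) ^ (n + 1))]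
    simpa using hi
  have hval : ∫ z : Fin n → ℝ, 1 / max R (c * ‖z‖) ^ (n + 1) ≤
      n * 2 ^ n * (2 / (R * c ^ n)) := by
    rw [integral_fun_norm_addHaar (volume : Measure (Fin n → ℝ))
      (fun y => 1 / max R (c * y) ^ (n + 1)), Module.finrank_fin_fun, measureReal_def,
      Real.volume_pi_ball _ one_pos, nsmul_eq_mul, smul_eq_mul, Fintype.card_fin, mul_one,
      ENNReal.toReal_ofReal (by positivity), mul_assoc]
    gcongr
  have hM : ∀ z : Fin n → ℝ, 0 < max R (c * ‖z‖) := fun z => lt_max_of_lt_left hR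
  simp_rw [fun z : Fin n → ℝ => (mul_one_div b (max R (c * ‖z‖) ^ (n + 1))).symm]
  rw [← ofReal_integral_eq_lintegral_ofReal (hint.const_mul b)
    (Filter.Eventually.of_forall fun z => by have := hM z; positivity), integral_const_mul]
  gcongr

theorem abs_min_sub_le {A b R T S : ℝ} {p : ℕ} (hp : p ≠ 0) (hb : 0 < b)
    (hR : R = A / b) (hR0 : 0 < R) (hS : 0 ≤ S) (hT : T ≤ S) :
    |min (A / S ^ (p + 1) - b / S ^ p) 0| ≤ b / max R T ^ p := by
  have hM : 0 < max R T := lt_max_of_lt_left hR0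
  rcases le_or_gt 0 (A / S ^ (p + 1) - b / S ^ p) with h | h
  · rw [min_eq_right h, abs_zero]
    positivity
  · have hS0 : 0 < S := by
      refine hS.lt_of_ne fun h0 => ?_
      simp [← h0, hp] at h
    have hA : 0 < A := by
      rw [hR] at hR0
      simpa [hb] using (div_pos_iff_of_pos_right hb).1 hR0
    have hRS : R ≤ S := by
      rw [sub_neg, pow_succ, ← div_div, div_right_comm,
        div_lt_div_iff_of_pos_right (by positivity), div_lt_iff₀ hS0] at h
      rw [hR, div_le_iff₀ hb]
      linarith
    rw [min_eq_left h.le, abs_of_neg h]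
    calc -(A / S ^ (p + 1) - b / S ^ p) ≤ b / S ^ p := by
          have : 0 < A / S ^ (p + 1) := by positivity
          linarith
      _ ≤ b / max R T ^ p := by
          gcongr
          exact max_le hRS hT

theorem mul_abs_sub_le_pairSum (p : ℕ) (x : Fin p → ℝ) (a b : Fin p) :
    (p : ℝ) / 2 * |x a - x b| ≤ pairSum p x := by
  have hD := two_mul_pairSum p x
  have hrow : ∀ i, 0 ≤ ∑ j, |x i - x j| := fun i => Finset.sum_nonneg fun j _ => abs_nonneg _
  suffices (p : ℝ) * |x a - x b| ≤ ∑ i, ∑ j, |x i - x j| by linarith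
  rcases eq_or_ne a b with rfl | hab
  · simpa using Finset.sum_nonneg fun i _ => hrow i
  calc (p : ℝ) * |x a - x b| = ∑ _j : Fin p, |x a - x b| := by simp
    _ ≤ ∑ j, (|x a - x j| + |x b - x j|) := Finset.sum_le_sum fun j _ => by
        rw [abs_sub_comm (x b)]
        exact abs_sub_le _ _ _
    _ = ∑ i ∈ {a, b}, ∑ j, |x i - x j| := by
        rw [Finset.sum_pair hab, Finset.sum_add_distrib]
    _ ≤ ∑ i, ∑ j, |x i - x j| :=
        Finset.sum_le_sum_of_subset_of_nonneg (Finset.subset_univ _) fun i _ _ => hrow i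

theorem mul_norm_le_pairSum_joinAt {p : ℕ} (hp : 1 ≤ p) (z : Fin (p - 1) → ℝ) :
    (p : ℝ) / 2 * ‖z‖ ≤ pairSum p (joinAt p 1 hp (fun _ => 0) z) := by
  have hS : 0 ≤ pairSum p (joinAt p 1 hp (fun _ => 0) z) :=
    Finset.sum_nonneg fun q _ => abs_nonneg _
  have hp0 : (0 : ℝ) < p / 2 := by positivity
  rw [← le_div_iff₀' hp0, pi_norm_le_iff_of_nonneg (by positivity)]
  intro i
  rw [le_div_iff₀' hp0]
  have h := mul_abs_sub_le_pairSum p (joinAt p 1 hp (fun _ => 0) z)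
    (Fin.cast (Nat.add_sub_cancel' hp) (Fin.natAdd 1 i))
    (Fin.cast (Nat.add_sub_cancel' hp) (Fin.castAdd (p - 1) 0))
  simpa [joinAt] using h

theorem three_mul_sq_le_floor_half_mul {p : ℕ} (hp : 2 ≤ p) :
    (3 / 16 : ℝ) * (p : ℝ) ^ 2 ≤ (((p - p / 2) * (p / 2) : ℕ) : ℝ) := by
  have h : 3 * p ^ 2 ≤ 16 * ((p - p / 2) * (p / 2)) := by
    obtain ⟨k, hk | hk⟩ := Nat.even_or_odd' p
    · have h1 : p / 2 = k := by omega
      have h2 : p - p / 2 = k := by omega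
      rw [h2, h1, hk]
      nlinarith
    · have h1 : p / 2 = k := by omega
      have h2 : p - p / 2 = k + 1 := by omega
      rw [h2, h1, hk]
      have : 1 ≤ k := by omega
      nlinarith
  have h' : (3 : ℝ) * (p : ℝ) ^ 2 ≤ 16 * (((p - p / 2) * (p / 2) : ℕ) : ℝ) := by
    exact_mod_cast h
  linarith

theorem sq_mul_le_of_lt_rpow_div {ε b : ℝ} (hε : 0 < ε) {p : ℕ} (hp : 1 ≤ p) (hb : 0 < b)
    (h : b < (p : ℝ) ^ (((p : ℝ) - 4) / 2 - ε) / (2 : ℝ) ^ ((2 * (p : ℝ) - 1) / 2)) :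
    b ^ 2 * ((p : ℝ) ^ 4 * 4 ^ p) ≤ 2 * (p : ℝ) ^ p := by
  have hp1 : (1 : ℝ) ≤ p := by exact_mod_cast hp
  have hp0 : (0 : ℝ) < p := by linarith
  have hle : b ≤ (p : ℝ) ^ (((p : ℝ) - 4) / 2) / (2 : ℝ) ^ ((2 * (p : ℝ) - 1) / 2) := by
    refine h.le.trans ?_
    gcongr
    linarith
  have hnum : ((p : ℝ) ^ (((p : ℝ) - 4) / 2)) ^ 2 = (p : ℝ) ^ p / (p : ℝ) ^ 4 := by
    rw [← Real.rpow_mul_natCast hp0.le]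
    push_cast
    rw [div_mul_cancel₀ _ two_ne_zero, Real.rpow_sub hp0, Real.rpow_natCast]
    norm_cast
  have hden : ((2 : ℝ) ^ ((2 * (p : ℝ) - 1) / 2)) ^ 2 = 4 ^ p / 2 := by
    rw [← Real.rpow_mul_natCast two_pos.le]
    push_cast
    rw [div_mul_cancel₀ _ two_ne_zero, Real.rpow_sub two_pos, Real.rpow_mul two_pos.le,
      Real.rpow_natCast, Real.rpow_one]
    norm_num
  have hsq := pow_le_pow_left₀ hb.le hle 2
  rw [div_pow, hnum, hden] at hsq
  calc b ^ 2 * ((p : ℝ) ^ 4 * 4 ^ p)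
      ≤ (p : ℝ) ^ p / (p : ℝ) ^ 4 / (4 ^ p / 2) * ((p : ℝ) ^ 4 * 4 ^ p) := by gcongr
    _ = 2 * (p : ℝ) ^ p := by field_simp

theorem weighted_bound_le {p : ℕ} (hp : 2 ≤ p) {a b : ℝ} (hb : 0 < b)
    (ha : (3 / 16 : ℝ) * (p : ℝ) ^ 2 ≤ a)
    (hb2 : b ^ 2 * ((p : ℝ) ^ 4 * 4 ^ p) ≤ 2 * (p : ℝ) ^ p) :
    (p : ℝ) ^ (p + 1) * (b * (((p - 1 : ℕ) : ℝ) * 2 ^ (p - 1) *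
      (2 / (a ^ (p + 1) / b * ((p : ℝ) / 2) ^ (p - 1))))) ≤
      16 / 3 * ((16 / 3) ^ p / p.factorial) := by
  obtain ⟨n, rfl⟩ := Nat.exists_eq_add_of_le' (show 1 ≤ p by omega)
  rw [Nat.add_sub_cancel]
  set q : ℝ := ((n + 1 : ℕ) : ℝ) with hq
  have hq1 : (1 : ℝ) ≤ q := by rw [hq]; exact_mod_cast Nat.le_add_left 1 n
  have hq0 : 0 < q := by linarith
  have ha0 : 0 < a := lt_of_lt_of_le (by positivity) ha
  have hnq : (n : ℝ) ≤ q := by rw [hq]; exact_mod_cast Nat.le_succ n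
  have hfac : ((n + 1).factorial : ℝ) ≤ q ^ (n + 1) := by
    rw [hq]; exact_mod_cast Nat.factorial_le_pow (n + 1)
  have hfac0 : (0 : ℝ) < (n + 1).factorial := by exact_mod_cast Nat.factorial_pos _
  have hb2' : b ^ 2 ≤ 2 * q ^ (n + 1) / (q ^ 4 * 4 ^ (n + 1)) := by
    rwa [le_div_iff₀ (by positivity)]
  calc q ^ (n + 1 + 1) * (b * ((n : ℝ) * 2 ^ n * (2 / (a ^ (n + 1 + 1) / b * (q / 2) ^ n))))
      = q ^ (n + 2) * n * 2 ^ n * 2 * b ^ 2 / (a ^ (n + 2) * (q / 2) ^ n) := by field_simp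
    _ ≤ q ^ (n + 2) * q * 2 ^ n * 2 * (2 * q ^ (n + 1) / (q ^ 4 * 4 ^ (n + 1))) /
          ((3 / 16 * q ^ 2) ^ (n + 2) * (q / 2) ^ n) := by gcongr
    _ = (16 / 3) ^ (n + 2) / q ^ (n + 4) := by
        rw [show (4 : ℝ) ^ (n + 1) = 2 ^ n * 2 ^ n * 4 by
          rw [pow_succ, ← mul_pow]; norm_num]
        rw [mul_pow, div_pow, div_pow, div_pow, ← pow_mul]
        field_simp
        ring
    _ ≤ (16 / 3) ^ (n + 2) / (n + 1).factorial := by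
        gcongr
        exact hfac.trans (pow_le_pow_right₀ hq1 (by omega))
    _ = 16 / 3 * ((16 / 3) ^ (n + 1) / (n + 1).factorial) := by ring

theorem statement13 (ε : ℝ) (hε : 0 < ε) (B : ℕ → ℝ)
    (hB : ∀ p, 2 ≤ p → 0 < B p ∧
      B p < (p : ℝ) ^ (((p : ℝ) - 4) / 2 - ε) / (2 : ℝ) ^ ((2 * (p : ℝ) - 1) / 2)) :
    (∑' p : ℕ,
        if h : 2 ≤ p then
          (p : ℝ≥0∞) ^ (p + 1) *
            ∫⁻ z : Fin (p - 1) → ℝ,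
              ENNReal.ofReal
                |min
                  ((((p - p / 2) * (p / 2) : ℕ) : ℝ) ^ (p + 1) /
                      pairSum p (joinAt p 1 (by omega) (fun _ => 0) z) ^ (p + 1) -
                    B p / pairSum p (joinAt p 1 (by omega) (fun _ => 0) z) ^ p)
                  0|
        else 0) ≠ ⊤ := by
  refine ne_top_of_le_ne_top (Summable.tsum_ofReal_lt_top
    ((Real.summable_pow_div_factorial (16 / 3)).mul_left (16 / 3))).ne
    (ENNReal.tsum_le_tsum fun p => ?_)
  split_ifs with h
  swap
  · exact zero_le
  obtain ⟨hb, hlt⟩ := hB p h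
  have ha := three_mul_sq_le_floor_half_mul h
  have hp0 : (0 : ℝ) < p := by exact_mod_cast (by omega : 0 < p)
  set a : ℝ := (((p - p / 2) * (p / 2) : ℕ) : ℝ)
  have ha0 : 0 < a := lt_of_lt_of_le (by positivity) ha
  have hR : 0 < a ^ (p + 1) / B p := by positivity
  have hint := lintegral_inv_max_norm_pow_le hR (half_pos hp0) hb.le (show 1 ≤ p - 1 by omega)
  rw [Nat.sub_add_cancel (show 1 ≤ p by omega)] at hint
  refine (mul_le_mul_right ((lintegral_mono fun z => ENNReal.ofReal_le_ofReal
    (abs_min_sub_le (by omega) hb rfl hR (Finset.sum_nonneg fun q _ => abs_nonneg _)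
      (mul_norm_le_pairSum_joinAt (by omega) z))).trans hint) _).trans ?_
  rw [← ENNReal.ofReal_natCast, ← ENNReal.ofReal_pow hp0.le,
    ← ENNReal.ofReal_mul (by positivity)]
  exact ENNReal.ofReal_le_ofReal (weighted_bound_le h hb ha
    (sq_mul_le_of_lt_rpow_div hε (by omega) hb hlt))
end
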